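/- Define g : ℝ → ℂ by g(x) = Σ_{d=1}^∞ ((−1)^d / d³)·e^{i d x} (an absolutely convergent series). Then for every x in the open interval (−π, π), g is three times differentiable at x and its third derivative satisfies g'''(x) = i/2 − (1/2)·tan(x/2). -/

import Mathlib

open Complex Real

/-- The function `g(x) = Σ_{d=1}^∞ ((−1)^d/d³)·e^{i d x}` (indexed by `d = n+1`, `n : ℕ`). -/
noncomputable def gSeries : ℝ → ℂ := fun x =>
  ∑' n : ℕ, ((-1 : ℂ) ^ (n + 1) / ((n + 1 : ℕ) : ℂ) ^ 3) *
    Complex.exp (Complex.I * ((n + 1 : ℕ) : ℂ) * (x : ℂ))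

lemma aux_exp (c : ℂ) (x : ℝ) (d : ℂ) : HasDerivAt (fun y : ℝ => c * Complex.exp (Complex.I * d * (y : ℂ)))
    (c * (Complex.I * d) * Complex.exp (Complex.I * d * (x : ℂ))) x := by
  have h : HasDerivAt (fun y : ℂ => c * Complex.exp (Complex.I * d * y))
    (c * (Complex.I * d) * Complex.exp (Complex.I * d * (x : ℂ))) (x : ℂ) := by
    have := (((hasDerivAt_id (x : ℂ)).const_mul (Complex.I * d)).cexp).const_mul c
    convert! this using 1
    simp; ring
  exact h.comp_ofReal

lemma aux_norm (n : ℕ) (x : ℝ) : ‖Complex.exp (Complex.I * ((n + 1 : ℕ) : ℂ) * (x : ℂ))‖ = 1 := by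
  have : Complex.I * ((n + 1 : ℕ) : ℂ) * (x : ℂ) = (((n + 1 : ℕ) * x : ℝ) : ℂ) * Complex.I := by
    push_cast; ring
  rw [this, Complex.norm_exp_ofReal_mul_I]

lemma aux_sum (k : ℕ) (hk : 1 < k) : Summable fun n : ℕ => 1 / ((n + 1 : ℕ) : ℝ) ^ k :=
  (summable_nat_add_iff 1).2 (Real.summable_one_div_nat_pow.2 hk)

lemma aux_nc (n : ℕ) : ‖((n + 1 : ℕ) : ℂ)‖ = ((n + 1 : ℕ) : ℝ) := Complex.norm_natCast _

/-- damped dilogarithm -/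
noncomputable def hS (r : ℝ) : ℝ → ℂ := fun x =>
  ∑' n : ℕ, ((-1 : ℂ) ^ (n + 1) * (r : ℂ) ^ (n + 1) / ((n + 1 : ℕ) : ℂ) ^ 2) *
    Complex.exp (Complex.I * ((n + 1 : ℕ) : ℂ) * (x : ℂ))

lemma norm3 (n : ℕ) (x : ℝ) : ‖((-1 : ℂ) ^ (n + 1) / ((n + 1 : ℕ) : ℂ) ^ 3) *
        Complex.exp (Complex.I * ((n + 1 : ℕ) : ℂ) * (x : ℂ))‖ = 1 / ((n + 1 : ℕ) : ℝ) ^ 3 := by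
  rw [norm_mul, aux_norm, norm_div, norm_pow, norm_pow, aux_nc]; simp

lemma norm2 (r : ℝ) (n : ℕ) (x : ℝ) :
    ‖((-1 : ℂ) ^ (n + 1) * (r : ℂ) ^ (n + 1) / ((n + 1 : ℕ) : ℂ) ^ 2) *
        Complex.exp (Complex.I * ((n + 1 : ℕ) : ℂ) * (x : ℂ))‖ =
      |r| ^ (n + 1) / ((n + 1 : ℕ) : ℝ) ^ 2 := by
  rw [norm_mul, aux_norm, norm_div, norm_mul, norm_pow, norm_pow, norm_pow, aux_nc]; simp

lemma sum3 (x : ℝ) : Summable fun n : ℕ =>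
      ‖((-1 : ℂ) ^ (n + 1) / ((n + 1 : ℕ) : ℂ) ^ 3) *
        Complex.exp (Complex.I * ((n + 1 : ℕ) : ℂ) * (x : ℂ))‖ := by
  simp_rw [norm3]; exact aux_sum 3 (by norm_num)

lemma norm2_le (r : ℝ) (hr : |r| ≤ 1) (n : ℕ) (x : ℝ) :
    ‖((-1 : ℂ) ^ (n + 1) * (r : ℂ) ^ (n + 1) / ((n + 1 : ℕ) : ℂ) ^ 2) *
        Complex.exp (Complex.I * ((n + 1 : ℕ) : ℂ) * (x : ℂ))‖ ≤
      1 / ((n + 1 : ℕ) : ℝ) ^ 2 := by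
  rw [norm2]
  have : |r| ^ (n+1) ≤ 1 := pow_le_one₀ (abs_nonneg _) hr
  gcongr

lemma sum2 (r : ℝ) (hr : |r| ≤ 1) (x : ℝ) : Summable fun n : ℕ =>
      ((-1 : ℂ) ^ (n + 1) * (r : ℂ) ^ (n + 1) / ((n + 1 : ℕ) : ℂ) ^ 2) *
        Complex.exp (Complex.I * ((n + 1 : ℕ) : ℂ) * (x : ℂ)) :=
  Summable.of_norm_bounded (aux_sum 2 (by norm_num)) (fun n => norm2_le r hr n x)

lemma d1 (x : ℝ) : HasDerivAt gSeries (Complex.I * hS 1 x) x := by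
  have := hasDerivAt_tsum (𝕜 := ℝ) (aux_sum 2 (by norm_num))
    (fun (n : ℕ) (y : ℝ) => aux_exp ((-1 : ℂ) ^ (n + 1) / ((n + 1 : ℕ) : ℂ) ^ 3) y ((n + 1 : ℕ) : ℂ))
    (fun n y => ?_) (sum3 0).of_norm x
  · convert! this using 1
    rw [hS, ← tsum_mul_left]
    refine tsum_congr fun n => ?_
    have : ((n + 1 : ℕ) : ℂ) ≠ 0 := Nat.cast_ne_zero.2 n.succ_ne_zero
    field_simp
    simp
  · rw [norm_mul, aux_norm, norm_mul, norm_div, norm_pow, norm_pow, norm_mul, aux_nc]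
    have : ((n + 1 : ℕ) : ℝ) ≠ 0 := Nat.cast_ne_zero.2 n.succ_ne_zero
    simp only [norm_neg, norm_one, one_pow, Complex.norm_I]
    apply le_of_eq
    field_simp

lemma d2r (r : ℝ) (h0 : 0 < r) (h1 : r < 1) (x : ℝ) :
    HasDerivAt (hS r) (-Complex.I * Complex.log (1 + r * Complex.exp (Complex.I * x))) x := by
  have hs : Summable fun n : ℕ => r ^ (n + 1) :=
    (summable_nat_add_iff 1).2 (summable_geometric_of_lt_one h0.le h1)
  have := hasDerivAt_tsum (𝕜 := ℝ) hs
    (fun (n : ℕ) (y : ℝ) => aux_exp ((-1 : ℂ) ^ (n + 1) * (r : ℂ) ^ (n + 1) / ((n + 1 : ℕ) : ℂ) ^ 2) y ((n + 1 : ℕ) : ℂ))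
    (fun n y => ?_) (sum2 r (by rw [abs_of_pos h0]; exact h1.le) 0) x
  · convert! this using 1
    have hz : ‖-((r : ℂ) * Complex.exp (Complex.I * x))‖ < 1 := by
      rw [norm_neg, norm_mul, mul_comm Complex.I, Complex.norm_exp_ofReal_mul_I, Complex.norm_real,
        Real.norm_eq_abs, abs_of_pos h0]
      simpa using h1
    have hl := (hasSum_nat_add_iff' 1).2 (Complex.hasSum_taylorSeries_neg_log hz)
    have hl2 := (hl.mul_left Complex.I).tsum_eq
    rw [sub_neg_eq_add] at hl2
    simp only [Finset.range_one, Finset.sum_singleton, Nat.cast_zero, div_zero, sub_zero] at hl2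
    rw [neg_mul, ← mul_neg, ← hl2]
    refine tsum_congr fun n => ?_
    have : ((n + 1 : ℕ) : ℂ) ≠ 0 := Nat.cast_ne_zero.2 n.succ_ne_zero
    have he : Complex.exp (Complex.I * ((n + 1 : ℕ) : ℂ) * (x : ℂ)) =
        Complex.exp (Complex.I * x) ^ (n + 1) := by
      rw [← Complex.exp_nat_mul]; congr 1; ring
    rw [he, neg_eq_neg_one_mul, mul_pow, mul_pow]
    field_simp
  · rw [norm_mul, aux_norm, norm_mul, norm_div, norm_mul, norm_pow, norm_pow, norm_pow, norm_mul, aux_nc]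
    simp only [norm_neg, norm_one, one_pow, Complex.norm_I, Complex.norm_real, Real.norm_eq_abs,
      abs_of_pos h0, one_mul, mul_one]
    have h3 : (1 : ℝ) ≤ ((n + 1 : ℕ) : ℝ) := by exact_mod_cast Nat.succ_le_succ n.zero_le
    have h4 : (0 : ℝ) < r ^ (n + 1) := by positivity
    have : r ^ (n + 1) / ((n + 1 : ℕ) : ℝ) ^ 2 * ((n + 1 : ℕ) : ℝ) = r ^ (n + 1) / ((n + 1 : ℕ) : ℝ) := by
      field_simp
    rw [this]
    exact div_le_self h4.le h3

lemma hlim (x : ℝ) : Filter.Tendsto (fun r => hS r x) (nhdsWithin 1 (Set.Iio 1)) (nhds (hS 1 x)) := by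
  refine tendsto_tsum_of_dominated_convergence (aux_sum 2 (by norm_num)) (fun n => ?_) ?_
  · apply Filter.Tendsto.mono_left _ nhdsWithin_le_nhds
    apply Continuous.tendsto (f := fun r : ℝ => ((-1 : ℂ) ^ (n + 1) * (r : ℂ) ^ (n + 1) / ((n + 1 : ℕ) : ℂ) ^ 2) *
        Complex.exp (Complex.I * ((n + 1 : ℕ) : ℂ) * (x : ℂ)))
    fun_prop
  · filter_upwards [Ioo_mem_nhdsLT (zero_lt_one (α := ℝ))] with r hr n
    exact norm2_le r (by rw [abs_of_pos hr.1]; exact hr.2.le) n x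

lemma re_pos' (x : ℝ) (hx : x ∈ Set.Ioo (-Real.pi) Real.pi) :
    0 < (1 + Complex.exp (Complex.I * x)).re := by
  have h2 : 0 < Real.cos (x / 2) := Real.cos_pos_of_mem_Ioo ⟨by linarith [hx.1], by linarith [hx.2]⟩
  have : (1 + Complex.exp (Complex.I * x)).re = 1 + Real.cos x := by
    rw [mul_comm, Complex.add_re, Complex.exp_ofReal_mul_I_re, Complex.one_re]
  rw [this]
  have h := Real.cos_sq (x / 2)
  rw [mul_div_cancel₀ _ (two_ne_zero)] at h
  nlinarith [sq_pos_of_pos h2]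

lemma d2 (x : ℝ) (hx : x ∈ Set.Ioo (-Real.pi) Real.pi) :
    HasDerivAt (hS 1) (-Complex.I * Complex.log (1 + Complex.exp (Complex.I * x))) x := by
  let L : ℝ → ℝ → ℂ := fun r y => -Complex.I * Complex.log (1 + r * Complex.exp (Complex.I * y))
  have hc : ContinuousAt (fun p : ℝ × ℝ => L p.1 p.2) (1, x) := by
    refine ContinuousAt.mul continuousAt_const (ContinuousAt.clog (by fun_prop) (Or.inl ?_))
    simpa using re_pos' x hx
  have hc2 : ContinuousAt (fun y : ℝ => L 1 y) x :=
    ContinuousAt.comp (g := fun p : ℝ × ℝ => L p.1 p.2) (f := fun y : ℝ => ((1 : ℝ), y)) hc (by fun_prop)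
  have := hasDerivAt_of_tendstoUniformlyOnFilter (𝕜 := ℝ) (l := nhdsWithin (1 : ℝ) (Set.Iio 1)) (f := hS)
    (f' := L) (g' := L 1) (g := hS 1) (x := x) ?_ ?_ (Filter.Eventually.of_forall hlim)
  · simpa [L] using this
  · rw [tendstoUniformlyOnFilter_iff_tendsto]
    refine Filter.Tendsto.mono_right ?_ (nhds_le_uniformity (L 1 x))
    rw [nhds_prod_eq]
    refine Filter.Tendsto.prodMk (hc2.tendsto.comp Filter.tendsto_snd) (hc.tendsto.mono_left ?_)
    rw [nhds_prod_eq]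
    exact Filter.prod_mono nhdsWithin_le_nhds le_rfl
  · have h := Ioo_mem_nhdsLT (zero_lt_one (α := ℝ))
    filter_upwards [Filter.tendsto_fst.eventually h] with p hp
    exact d2r p.1 hp.1 hp.2 p.2

lemma d3 (x : ℝ) (hx : x ∈ Set.Ioo (-Real.pi) Real.pi) :
    HasDerivAt (fun y : ℝ => Complex.log (1 + Complex.exp (Complex.I * y)))
      (Complex.I / 2 - (1 / 2) * (Real.tan (x / 2) : ℂ)) x := by
  have hp := re_pos' x hx
  have h := ((((hasDerivAt_id (x : ℂ)).const_mul Complex.I).cexp).const_add 1).clog (Or.inl hp)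
  have h' := HasDerivAt.comp_ofReal h
  convert! h' using 1
  have hne : 1 + Complex.exp (Complex.I * x) ≠ 0 := by
    intro h0; rw [h0] at hp; simp at hp
  have h2 : 0 < Real.cos (x / 2) := Real.cos_pos_of_mem_Ioo ⟨by linarith [hx.1], by linarith [hx.2]⟩
  have h2c : Complex.cos (x / 2) ≠ 0 := by
    have : ((Real.cos (x / 2) : ℝ) : ℂ) ≠ 0 := by exact_mod_cast h2.ne'
    simpa using this
  have he : Complex.exp (Complex.I * x) = (Complex.cos (x / 2) + Complex.sin (x / 2) * Complex.I) ^ 2 := by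
    rw [← Complex.exp_mul_I, ← Complex.exp_nat_mul]; congr 1; push_cast; ring
  simp only [id, mul_one]
  rw [eq_div_iff hne, he, Complex.ofReal_tan, Complex.tan_eq_sin_div_cos]
  push_cast
  have hcs := Complex.sin_sq_add_cos_sq ((x : ℂ) / 2)
  generalize Complex.sin ((x : ℂ) / 2) = s at *
  generalize Complex.cos ((x : ℂ) / 2) = c at *
  have h1 : (1 : ℂ) + (c + s * Complex.I) ^ 2 = 2 * c * (c + s * Complex.I) := by
    linear_combination (-1 : ℂ) * hcs + s ^ 2 * Complex.I_sq
  rw [h1]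
  field_simp
  linear_combination (-(Complex.I * s ^ 2 + c * s)) * Complex.I_sq

/-- `g(x) = Σ_{d≥1} ((−1)^d/d³) e^{i d x}` is an absolutely convergent series,
and for every `x ∈ (−π, π)`, `g` is three times differentiable at `x` with
`g'''(x) = i/2 − (1/2)·tan(x/2)`. -/
theorem stmt_8 :
    (∀ x : ℝ, Summable fun n : ℕ =>
      ‖((-1 : ℂ) ^ (n + 1) / ((n + 1 : ℕ) : ℂ) ^ 3) *
        Complex.exp (Complex.I * ((n + 1 : ℕ) : ℂ) * (x : ℂ))‖) ∧
    ∀ x ∈ Set.Ioo (-Real.pi) Real.pi,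
      DifferentiableAt ℝ gSeries x ∧
      DifferentiableAt ℝ (deriv gSeries) x ∧
      DifferentiableAt ℝ (deriv (deriv gSeries)) x ∧
      deriv (deriv (deriv gSeries)) x =
        Complex.I / 2 - (1 / 2) * (Real.tan (x / 2) : ℂ) := by

  refine ⟨sum3, fun x hx => ?_⟩
  have e1 : deriv gSeries = fun y => Complex.I * hS 1 y := funext fun y => (d1 y).deriv
  have D2 : ∀ y ∈ Set.Ioo (-Real.pi) Real.pi, HasDerivAt (deriv gSeries)
      (Complex.log (1 + Complex.exp (Complex.I * y))) y := by
    intro y hy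
    rw [e1]
    convert! (d2 y hy).const_mul Complex.I using 1
    rw [← mul_assoc, mul_neg, Complex.I_mul_I]; simp
  have e2 : deriv (deriv gSeries) =ᶠ[nhds x]
      fun y : ℝ => Complex.log (1 + Complex.exp (Complex.I * y)) := by
    filter_upwards [Ioo_mem_nhds hx.1 hx.2] with y hy
    exact (D2 y hy).deriv
  have D3 := (d3 x hx).congr_of_eventuallyEq e2
  exact ⟨(d1 x).differentiableAt, (D2 x hx).differentiableAt, D3.differentiableAt, D3.deriv⟩
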